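/- arXiv:math/0509220 — 4 statements merged into one kernel-verified Lean document; each statement's English description precedes it below -/
import Mathlib

section
/- Let V = ⨁_{i∈I} V_i be a finite direct sum of finite-dimensional ℂ-vector spaces, where each V_i carries a nondegenerate symmetric bilinear form B_i, and let B be the orthogonal-sum form on V (so B restricted to V_i is B_i and distinct summands are orthogonal). Let K ⊆ V be a subspace with K ⊆ K^⊥, where K^⊥ = {v ∈ V : B(v, k) = 0 for all k ∈ K}. Then there exist linear maps L_i : V_i → V_i, each self-adjoint with respect to B_i, such that the direct-sum map L = ⨁ L_i : V → V satisfies K^⊥ ∩ L(K) = 0. -/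
/-- Some of the rank-one forms attached to a finite family of functionals add up to a symmetric
form whose radical is the common kernel of the family. -/
theorem exists_finset_forall_sum_mul_eq_zero {k E ι : Type*} [Field k] [AddCommGroup E]
    [Module k E] [Finite ι] (c : ι → E →ₗ[k] k) :
    ∃ s : Finset ι, ∀ x : E, (∀ y, ∑ p ∈ s, c p x * c p y = 0) → ∀ p, c p x = 0 := by
  classical
  obtain ⟨κ, a, ha, hspan, hli⟩ := exists_linearIndependent' k c
  have : Finite κ := Finite.of_injective a ha
  have := Fintype.ofFinite κ
  refine ⟨Finset.univ.map ⟨a, ha⟩, fun x hx => ?_⟩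
  have h0 : ∀ q, c (a q) x = 0 := by
    refine Fintype.linearIndependent_iff.1 hli (fun q => c (a q) x) ?_
    ext y
    simpa using hx y
  have hle : Submodule.span k (Set.range (c ∘ a)) ≤ LinearMap.ker (LinearMap.applyₗ x) := by
    rw [Submodule.span_le]
    rintro _ ⟨q, rfl⟩
    simpa using h0 q
  intro p
  have hp : c p ∈ Submodule.span k (Set.range (c ∘ a)) := by
    rw [hspan]
    exact Submodule.subset_span ⟨p, rfl⟩
  simpa using hle hp


/-- Lemma 3.7 of the paper. Let `V = ⨁_{i∈I} V_i` be a finite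
direct sum of finite-dimensional `ℂ`-vector spaces, each `V_i` carrying a
nondegenerate symmetric bilinear form `B_i`, and let `B` be the orthogonal-sum
form on `V`.  If `K ⊆ V` is a subspace with `K ⊆ K^⊥`, then there exist
`B_i`-self-adjoint linear maps `L_i : V_i → V_i` such that `L = ⨁ L_i` satisfies
`K^⊥ ∩ L(K) = 0`. -/
theorem stmt5 (I : Type) [Fintype I] (V : I → Type)
    [∀ i, AddCommGroup (V i)] [∀ i, Module ℂ (V i)] [∀ i, FiniteDimensional ℂ (V i)]
    (B : ∀ i, LinearMap.BilinForm ℂ (V i))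
    (hB : ∀ i, (B i).Nondegenerate)
    (hsymm : ∀ i, ∀ x y : V i, B i x y = B i y x)
    (K : Submodule ℂ (∀ i, V i))
    (hK : ∀ x ∈ K, ∀ y ∈ K, (∑ i, B i (x i) (y i)) = 0) :
    ∃ L : ∀ i, V i →ₗ[ℂ] V i,
      (∀ i, ∀ x y : V i, B i (L i x) y = B i x (L i y)) ∧
      ∀ v : ∀ i, V i,
        v ∈ Submodule.map (LinearMap.pi fun i => (L i).comp (LinearMap.proj i)) K →
        (∀ k ∈ K, (∑ i, B i (v i) (k i)) = 0) →
        v = 0 := by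
  classical
  let b := fun i => Module.finBasis ℂ (V i)
  let c : (Σ i, Fin (Module.finrank ℂ (V i))) → K →ₗ[ℂ] ℂ := fun p =>
    (b p.1).coord p.2 ∘ₗ LinearMap.proj p.1 ∘ₗ K.subtype
  obtain ⟨s, hs⟩ := exists_finset_forall_sum_mul_eq_zero c
  let Q : ∀ i, LinearMap.BilinForm ℂ (V i) := fun i =>
    ∑ j, (if (⟨i, j⟩ : Σ i, Fin (Module.finrank ℂ (V i))) ∈ s then (1 : ℂ) else 0) •
      LinearMap.BilinForm.linMulLin ((b i).coord j) ((b i).coord j)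
  have hQ : ∀ i x y, Q i x y = ∑ j, if (⟨i, j⟩ : Σ i, Fin (Module.finrank ℂ (V i))) ∈ s then
      (b i).coord j x * (b i).coord j y else 0 := by
    intro i x y
    simp only [Q, LinearMap.sum_apply]
    refine Finset.sum_congr rfl fun j _ => ?_
    split_ifs <;> simp
  have hQsymm : ∀ i x y, Q i x y = Q i y x := by
    intro i x y
    simp only [hQ, mul_comm]
  let L : ∀ i, V i →ₗ[ℂ] V i := fun i => ((B i).toDual (hB i)).symm.toLinearMap ∘ₗ Q i
  have hL : ∀ i x y, B i (L i x) y = Q i x y := by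
    intro i x y
    simp [L]
  refine ⟨L, fun i x y => ?_, ?_⟩
  · rw [hL, hsymm i x, hL, hQsymm]
  · rintro _ ⟨x, hx, rfl⟩ h
    have h0 := hs ⟨x, hx⟩ fun y => by
      have hy := h y y.2
      simp only [LinearMap.pi_apply, LinearMap.comp_apply, LinearMap.proj_apply, hL, hQ] at hy
      rw [← Fintype.sum_sigma' (fun i j => if (⟨i, j⟩ : Σ i, Fin (Module.finrank ℂ (V i))) ∈ s then
        (b i).coord j (x i) * (b i).coord j ((y : ∀ i, V i) i) else 0)] at hy
      simpa [c, Finset.sum_ite_mem] using hy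
    have hx0 : x = 0 := by
      funext i
      exact (b i).forall_coord_eq_zero_iff.1 fun j => h0 ⟨i, j⟩
    rw [hx0, map_zero]
end

section
/- Let V be a finite-dimensional vector space over a field, let B be a symmetric bilinear form on V, and let W ⊆ V be a subspace on which B restricts to a nondegenerate form. Let K ⊆ V be a subspace with K ⊆ K^⊥, where K^⊥ = {v ∈ V : B(v, k) = 0 for all k ∈ K}. Then dim(K^⊥ ∩ W) + dim(K ∩ W) ≤ dim W. -/
/-- Let `V` be a finite-dimensional vector space over a field,
`B` a symmetric bilinear form on `V`, `W ⊆ V` a subspace on which `B` restricts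
to a nondegenerate form, and `K ⊆ V` a subspace with `K ⊆ K^⊥`.  Then
`dim(K^⊥ ∩ W) + dim(K ∩ W) ≤ dim W`. -/
theorem stmt6 (F : Type) [Field F] (V : Type) [AddCommGroup V] [Module F V]
    [FiniteDimensional F V]
    (B : LinearMap.BilinForm F V) (hsymm : ∀ x y : V, B x y = B y x)
    (W : Submodule F V) (hW : (B.restrict W).Nondegenerate)
    (K : Submodule F V) (hK : K ≤ B.orthogonal K) :
    Module.finrank F ↥(B.orthogonal K ⊓ W) + Module.finrank F ↥(K ⊓ W) ≤
      Module.finrank F ↥W := by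
  have hfin (S : Submodule F V) :
      Module.finrank F ↥(S ⊓ W) = Module.finrank F ↥(S.comap W.subtype) := by
    rw [inf_comm, ← Submodule.map_comap_subtype, Submodule.finrank_map_subtype_eq]
  have hle : (B.orthogonal K).comap W.subtype ≤
      (B.restrict W).orthogonal (K.comap W.subtype) :=
    fun x hx y hy => hx y hy
  have hdim := LinearMap.BilinForm.finrank_add_finrank_orthogonal'
    (B := B.restrict W) (K.comap W.subtype)
  rw [hW.ker_eq_bot, inf_bot_eq, finrank_bot, add_zero] at hdim
  have hmono := Submodule.finrank_mono hle
  rw [hfin, hfin]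
  lia
end

section
/- Equip ℂ^n with the standard symmetric bilinear form B(x, y) = Σ_{j=1}^n x_j y_j, and let K ⊆ ℂ^n be a subspace with K ⊆ K^⊥. Then there exists t = (t_1,…,t_n) ∈ (ℂ^×)^n such that the invertible diagonal map D_t : ℂ^n → ℂ^n, D_t(y_1,…,y_n) = (t_1 y_1,…,t_n y_n), satisfies K^⊥ ∩ D_t(K) = 0. -/
/-- Some finite set `S` of coordinates separates the points of `K` and carries, for each `j ∈ S`,
a vector of `K` whose only nonzero coordinate in `S` is the `j`-th. -/
theorem Submodule.exists_finset_separating_coordinates {ι R : Type*} [Finite ι] [Semiring R]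
    (K : Submodule R (ι → R)) :
    ∃ S : Finset ι, (∀ x ∈ K, (∀ j ∈ S, x j = 0) → x = 0) ∧
      ∀ j ∈ S, ∃ x ∈ K, x j ≠ 0 ∧ ∀ i ∈ S, i ≠ j → x i = 0 := by
  classical
  have := Fintype.ofFinite ι
  obtain ⟨S, hS⟩ := (Set.toFinite {S : Finset ι | ∀ x ∈ K, (∀ j ∈ S, x j = 0) → x = 0})
    |>.exists_minimal ⟨Finset.univ, fun x _ h => funext fun j => h j (Finset.mem_univ j)⟩
  refine ⟨S, hS.prop, fun j hj => ?_⟩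
  have hne : ¬ ∀ x ∈ K, (∀ i ∈ S.erase j, x i = 0) → x = 0 := fun h =>
    Finset.notMem_erase j S (hS.le_of_le h (Finset.erase_subset j S) hj)
  push Not at hne
  obtain ⟨x, hxK, hx, hx0⟩ := hne
  have hzero : ∀ i ∈ S, i ≠ j → x i = 0 := fun i hi hij => hx i (Finset.mem_erase.2 ⟨hij, hi⟩)
  refine ⟨x, hxK, fun hxj => hx0 (hS.prop x hxK fun i hi => ?_), hzero⟩
  by_cases hij : i = j
  · exact hij ▸ hxj
  · exact hzero i hi hij

/-- Equip `ℂ^n` with the standard symmetric bilinear form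
`B(x,y) = ∑ x_j y_j` and let `K ⊆ ℂ^n` be a subspace with `K ⊆ K^⊥`.  Then there
is `t ∈ (ℂ^×)^n` such that the diagonal map `D_t(y) = (t_1 y_1, …, t_n y_n)`
satisfies `K^⊥ ∩ D_t(K) = 0`. -/
theorem stmt7 (n : ℕ) (K : Submodule ℂ (Fin n → ℂ))
    (hK : ∀ x ∈ K, ∀ y ∈ K, (∑ j, x j * y j) = 0) :
    ∃ t : Fin n → ℂ, (∀ j, t j ≠ 0) ∧
      ∀ v : Fin n → ℂ,
        v ∈ Submodule.map (LinearMap.pi fun j => t j • LinearMap.proj j) K →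
        (∀ k ∈ K, (∑ j, v j * k j) = 0) →
        v = 0 := by
  classical
  obtain ⟨S, hsep, hdual⟩ := K.exists_finset_separating_coordinates
  refine ⟨fun j => 1 + if j ∈ S then 1 else 0, fun j => ?_, ?_⟩
  · dsimp only
    split_ifs <;> norm_num
  rintro _ ⟨y, hyK, rfl⟩ horth
  suffices hy : y = 0 by rw [hy, map_zero]
  refine hsep y hyK fun j hj => ?_
  obtain ⟨x, hxK, hxj, hx⟩ := hdual j hj
  have hsum := horth x hxK
  simp only [LinearMap.pi_apply, LinearMap.smul_apply, LinearMap.proj_apply, smul_eq_mul,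
    add_mul, one_mul, ite_mul, zero_mul, Finset.sum_add_distrib, hK y hyK x hxK, zero_add,
    Finset.sum_ite_mem, Finset.univ_inter] at hsum
  rw [Finset.sum_eq_single_of_mem j hj fun i hi hij => by rw [hx i hi hij, mul_zero]] at hsum
  exact (mul_eq_zero.1 hsum).resolve_right hxj
end

section
/- Equip ℂ^n with the standard symmetric bilinear form B(x, y) = Σ_{j=1}^n x_j y_j, and let K ⊆ ℂ^n be a subspace with K ⊆ K^⊥. Then the set of t = (t_1,…,t_n) ∈ (ℂ^×)^n for which the diagonal map D_t (given by D_t(y_1,…,y_n) = (t_1 y_1,…,t_n y_n)) satisfies K^⊥ ∩ D_t(K) = 0 contains a nonempty Zariski-open subset of (ℂ^×)^n; that is, there is a nonzero polynomial p ∈ ℂ[t_1,…,t_n] such that K^⊥ ∩ D_t(K) = 0 whenever all t_j ≠ 0 and p(t) ≠ 0. -/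
section DiagonalForm

variable {F ι : Type*} [Field F] [Fintype ι]

/-- The bilinear form `(x, y) ↦ ∑ j, t j * x j * y j` restricted to a subspace `K`. -/
def diagonalForm (K : Submodule F (ι → F)) (t : ι → F) : K →ₗ[F] K →ₗ[F] F :=
  LinearMap.mk₂ F (fun x y => ∑ j, t j * (x : ι → F) j * (y : ι → F) j)
    (fun _ _ _ => by simp [mul_add, add_mul, Finset.sum_add_distrib])
    (fun _ _ _ => by simp [Finset.mul_sum, mul_assoc, mul_left_comm])
    (fun _ _ _ => by simp [mul_add, Finset.sum_add_distrib])
    (fun _ _ _ => by simp [Finset.mul_sum, mul_left_comm])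

theorem diagonalForm_apply (K : Submodule F (ι → F)) (t : ι → F) (x y : K) :
    diagonalForm K t x y = ∑ j, t j * (x : ι → F) j * (y : ι → F) j :=
  rfl

/-- The coordinates can be cut down to a set `S` on which a subspace `K` projects bijectively. -/
theorem Submodule.exists_set_coordinates (K : Submodule F (ι → F)) :
    ∃ S : Set ι, (∀ y ∈ K, (∀ i ∈ S, y i = 0) → y = 0) ∧
      ∀ i ∈ S, ∃ k ∈ K, k i = 1 ∧ ∀ j ∈ S, j ≠ i → k j = 0 := by
  let f : ι → Module.Dual F K := fun j => LinearMap.proj j ∘ₗ K.subtype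
  obtain ⟨κ, a, ha, hspan, hli⟩ := exists_linearIndependent' F f
  refine ⟨Set.range a, fun y hy h => ?_, ?_⟩
  · ext j
    have hle : Submodule.span F (Set.range f) ≤
        LinearMap.ker (Module.Dual.eval F K ⟨y, hy⟩) := by
      rw [← hspan, Submodule.span_le]
      rintro _ ⟨i, rfl⟩
      exact h _ ⟨i, rfl⟩
    exact hle (Submodule.subset_span ⟨j, rfl⟩)
  · rintro _ ⟨i, rfl⟩
    obtain ⟨g, hg⟩ := LinearMap.exists_extend (Finsupp.lapply i ∘ₗ hli.repr)
    obtain ⟨k, rfl⟩ := (Module.evalEquiv F K).surjective g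
    have hk (l : κ) : (k : ι → F) (a l) = Finsupp.single l (1 : F) i := by
      let x : Submodule.span F (Set.range (f ∘ a)) :=
        ⟨f (a l), Submodule.subset_span (Set.mem_range_self l)⟩
      have h : (k : ι → F) (a l) = hli.repr x i := LinearMap.congr_fun hg x
      rw [h, hli.repr_eq_single l x rfl]
    refine ⟨k, k.2, by simp [hk], ?_⟩
    rintro _ ⟨l, rfl⟩ hl
    rw [hk, Finsupp.single_eq_of_ne fun h => hl (congrArg a h.symm)]

theorem exists_separatingLeft_diagonalForm (K : Submodule F (ι → F)) :
    ∃ t : ι → F, (diagonalForm K t).SeparatingLeft := by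
  classical
  obtain ⟨S, hinj, hsurj⟩ := K.exists_set_coordinates
  refine ⟨S.indicator 1, fun y hy => Subtype.ext (hinj y y.2 fun i hi => ?_)⟩
  obtain ⟨k, hkK, hki, hk⟩ := hsurj i hi
  have h := hy ⟨k, hkK⟩
  rw [diagonalForm_apply, Finset.sum_eq_single i] at h
  · simpa [hi, hki] using h
  · intro j _ hj
    by_cases hjS : j ∈ S
    · simp [hk j hjS hj]
    · simp [hjS]
  · simp

/-- Diagonal forms are generically nondegenerate on every subspace. -/
theorem exists_mvPolynomial_separatingLeft_diagonalForm (K : Submodule F (ι → F)) :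
    ∃ p : MvPolynomial ι F, p ≠ 0 ∧
      ∀ t : ι → F, MvPolynomial.eval t p ≠ 0 → (diagonalForm K t).SeparatingLeft := by
  let b := Module.finBasis F K
  let p : MvPolynomial ι F := Matrix.det (Matrix.of fun i k =>
    ∑ j, MvPolynomial.X j * MvPolynomial.C ((b i : ι → F) j) * MvPolynomial.C ((b k : ι → F) j))
  have hp (t : ι → F) :
      MvPolynomial.eval t p = (LinearMap.toMatrix₂ b b (diagonalForm K t)).det := by
    rw [RingHom.map_det]
    congr 1
    ext i k
    simp [diagonalForm_apply, LinearMap.toMatrix₂_apply]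
  obtain ⟨t₀, ht₀⟩ := exists_separatingLeft_diagonalForm K
  refine ⟨p, fun h => ?_, fun t ht => ?_⟩
  · rw [LinearMap.separatingLeft_iff_det_ne_zero b, ← hp, h, map_zero] at ht₀
    exact ht₀ rfl
  · rwa [LinearMap.separatingLeft_iff_det_ne_zero b, ← hp]

end DiagonalForm

/-- Equip `ℂ^n` with the standard symmetric bilinear form
`B(x,y) = ∑ x_j y_j` and let `K ⊆ ℂ^n` be a subspace with `K ⊆ K^⊥`.  Then the
set of `t ∈ (ℂ^×)^n` for which the diagonal map `D_t` satisfies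
`K^⊥ ∩ D_t(K) = 0` contains a nonempty Zariski-open subset: there is a nonzero
polynomial `p ∈ ℂ[t_1,…,t_n]` such that `K^⊥ ∩ D_t(K) = 0` whenever all
`t_j ≠ 0` and `p(t) ≠ 0`. -/
theorem stmt8 (n : ℕ) (K : Submodule ℂ (Fin n → ℂ))
    (hK : ∀ x ∈ K, ∀ y ∈ K, (∑ j, x j * y j) = 0) :
    ∃ p : MvPolynomial (Fin n) ℂ, p ≠ 0 ∧
      ∀ t : Fin n → ℂ, (∀ j, t j ≠ 0) → MvPolynomial.eval t p ≠ 0 →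
        ∀ v : Fin n → ℂ,
          v ∈ Submodule.map (LinearMap.pi fun j => t j • LinearMap.proj j) K →
          (∀ k ∈ K, (∑ j, v j * k j) = 0) →
          v = 0 := by
  obtain ⟨p, hp, hsep⟩ := exists_mvPolynomial_separatingLeft_diagonalForm K
  refine ⟨p, hp, ?_⟩
  rintro t - ht _ ⟨y, hy, rfl⟩ hv
  have hy0 : (⟨y, hy⟩ : K) = 0 := hsep t ht _ fun k => by
    simpa [diagonalForm_apply] using hv k k.2
  rw [show y = 0 from congrArg Subtype.val hy0, map_zero]
end
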